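/- arXiv:2511.18759 — 6 statements merged into one kernel-verified Lean document; each statement's English description precedes it below -/
import Mathlib

section
/- Let Σ_n = (K_n, σ, F_2^m) be a multisigned complete graph and let t ≥ 1 with 4t ≤ n. Suppose there exist 4t distinct vertices u_1, w_1, u'_1, w'_1, ..., u_t, w_t, u'_t, w'_t of K_n such that, letting D_i denote the 4-cycle u_i–w_i–u'_i–w'_i–u_i, the multisigns σ(D_1), ..., σ(D_t) span the vector space F_2^m. Then for every g ∈ F_2^m there exists a Hamiltonian circle H of Σ_n with σ(H) = g. -/
section MultisignedPaths

open scoped List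

variable {V A : Type*} [AddCommGroup A] (σ : Sym2 V → A)

/-- The sum of the edge labels along the path from `x` to `y` with list of inner vertices `l`. -/
def pathSign (x : V) (l : List V) (y : V) : A :=
  match l with
  | [] => σ s(x, y)
  | a :: l => σ s(x, a) + pathSign a l y

/-- The sum of the edge labels of the 4-cycle `q 0 – q 1 – q 2 – q 3 – q 0`. -/
def squareSign (q : Fin 4 → V) : A :=
  σ s(q 0, q 1) + σ s(q 1, q 2) + σ s(q 2, q 3) + σ s(q 3, q 0)

lemma pathSign_append_cons (x : V) (l : List V) (a : V) (r : List V) (y : V) :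
    pathSign σ x (l ++ a :: r) y = pathSign σ x l a + pathSign σ a r y := by
  induction l generalizing x with
  | nil => rfl
  | cons b l ih => simp [pathSign, ih, add_assoc]

lemma pathSign_reverse (x : V) (l : List V) (y : V) :
    pathSign σ x l.reverse y = pathSign σ y l x := by
  induction l generalizing y with
  | nil => simp [pathSign, Sym2.eq_swap]
  | cons b l ih =>
    rw [List.reverse_cons, pathSign_append_cons, ih]
    simp [pathSign, Sym2.eq_swap, add_comm]

lemma exists_walk_support_eq {x y : V} {l : List V} (h : (x :: (l ++ [y])).Nodup) :
    ∃ W : (⊤ : SimpleGraph V).Walk x y, W.support = x :: (l ++ [y]) ∧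
      (W.edges.map σ).sum = pathSign σ x l y := by
  induction l generalizing x with
  | nil =>
    have hxy : x ≠ y := by simpa using h
    exact ⟨.cons hxy .nil, by simp, by simp [pathSign]⟩
  | cons a l ih =>
    rw [List.cons_append, List.nodup_cons] at h
    obtain ⟨W, hW, hs⟩ := ih h.2
    have hxa : x ≠ a := fun e => h.1 (by simp [e])
    exact ⟨.cons hxa W, by simp [hW], by simp [pathSign, hs]⟩

lemma exists_isHamiltonianCycle_of_perm_univ [Fintype V] [DecidableEq V] {x : V} {l : List V}
    (hl : 2 ≤ l.length) (h : x :: l ~ (Finset.univ : Finset V).toList) :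
    ∃ H : (⊤ : SimpleGraph V).Walk x x, H.IsHamiltonianCycle ∧
      (H.edges.map σ).sum = pathSign σ x l x := by
  obtain _ | ⟨a, l⟩ := l
  · simp at hl
  have hnd : (x :: a :: l).Nodup := h.nodup_iff.mpr (Finset.nodup_toList _)
  have hxa : x ≠ a := fun e => (List.nodup_cons.mp hnd).1 (by simp [e])
  have hnd' : (a :: (l ++ [x])).Nodup :=
    (List.perm_append_comm (l₁ := a :: l) (l₂ := [x])).nodup_iff.mpr hnd
  obtain ⟨W, hW, hs⟩ := exists_walk_support_eq σ hnd'
  have hlen : W.length = l.length + 1 := by simpa [hW] using W.length_support.symm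
  refine ⟨.cons hxa W, ?_, by simp [pathSign, hs]⟩
  rw [SimpleGraph.Walk.isHamiltonianCycle_iff_isCycle_and_length_eq,
    SimpleGraph.Walk.isCycle_iff_isPath_tail_and_le_length]
  have hcard := h.length_eq
  simp only [List.length_cons, Finset.length_toList, Finset.card_univ] at hl hcard
  refine ⟨⟨?_, ?_⟩, ?_⟩
  · simpa [SimpleGraph.Walk.isPath_def, hW] using hnd'
  · rw [SimpleGraph.Walk.length_cons]; omega
  · rw [SimpleGraph.Walk.length_cons]; omega

variable [Module (ZMod 2) A]

/-- Swapping the two pairs of opposite edges of a square through which a path runs changes the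
multisign of the path by the multisign of the square. -/
lemma exists_pathSign_eq_add_smul_squareSign (q : Fin 4 → V) (p : List V) (a : ZMod 2) :
    ∃ p', p' ~ q 1 :: q 2 :: q 3 :: p ∧ ∀ y, pathSign σ (q 0) p' y =
      σ s(q 0, q 1) + pathSign σ (q 1) p (q 3) + σ s(q 2, q 3) + σ s(q 2, y)
        + a • squareSign σ q := by
  have hchar (v : A) : v + v = 0 := by
    rw [← two_smul (ZMod 2), show (2 : ZMod 2) = 0 from rfl, zero_smul]
  obtain rfl | rfl : a = 0 ∨ a = 1 := by revert a; decide
  · refine ⟨q 1 :: (p ++ [q 3, q 2]), ?_, fun y => ?_⟩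
    · refine List.Perm.cons _ (List.perm_append_comm.trans ?_)
      exact List.Perm.swap _ _ _
    · simp [pathSign, pathSign_append_cons, Sym2.eq_swap (a := q 3), add_assoc]
  · refine ⟨q 3 :: (p.reverse ++ [q 1, q 2]), ?_, fun y => ?_⟩
    · have h : q 3 :: (p.reverse ++ [q 1, q 2]) ~ [q 3] ++ ([q 1, q 2] ++ p) :=
        (List.perm_append_comm.trans ((List.reverse_perm p).append_left _)).cons _
      exact h.trans (List.perm_middle (l₁ := [q 1, q 2])).symm
    · simp only [pathSign, pathSign_append_cons, pathSign_reverse, squareSign, one_smul,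
        Sym2.eq_swap (a := q 3) (b := q 0)]
      have h₁ := hchar (σ s(q 0, q 1))
      have h₂ := hchar (σ s(q 2, q 3))
      rw [← sub_eq_zero]
      exact (by abel : _ =
        -((σ s(q 0, q 1) + σ s(q 0, q 1)) + (σ s(q 2, q 3) + σ s(q 2, q 3)))).trans
        (by rw [h₁, h₂]; simp)

/-- A vertex list running through the squares of `L` and through `M` can be rearranged so as to
add any element of the span of the multisigns of the squares, independently of its end links. -/
lemma exists_perm_pathSign_eq_add (M : List V) (L : List (Fin 4 → V)) :
    ∃ c : V → V → A, ∀ s ∈ Submodule.span (ZMod 2) (squareSign σ '' {q | q ∈ L}),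
      ∃ p, p ~ L.flatMap List.ofFn ++ M ∧ ∀ x y, pathSign σ x p y = c x y + s := by
  induction L with
  | nil => exact ⟨fun x y => pathSign σ x M y, fun s hs => ⟨M, by simp, by simp_all⟩⟩
  | cons q L ih =>
    obtain ⟨c, hc⟩ := ih
    refine ⟨fun x y => σ s(x, q 0) + (σ s(q 0, q 1) + c (q 1) (q 3) + σ s(q 2, q 3)
      + σ s(q 2, y)), fun s hs => ?_⟩
    have hset : {r | r ∈ q :: L} = insert q {r | r ∈ L} := by ext; simp
    rw [hset, Set.image_insert_eq, Submodule.mem_span_insert] at hs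
    obtain ⟨a, s, hs, rfl⟩ := hs
    obtain ⟨p, hp, hpc⟩ := hc s hs
    obtain ⟨p', hp', hp'c⟩ := exists_pathSign_eq_add_smul_squareSign σ q p a
    refine ⟨q 0 :: p', ?_, fun x y => ?_⟩
    · simpa [List.ofFn_succ] using hp'.trans (((hp.cons _).cons _).cons _)
    · rw [pathSign, hp'c, hpc]
      dsimp only
      abel

end MultisignedPaths

/-- C₄-necklace Lemma in `K_n`: if `K_n` contains `t ≥ 1` vertex-disjoint
4-cycles `D i = q i 0 – q i 1 – q i 2 – q i 3 – q i 0` (on `4t ≤ n` distinct vertices)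
whose multisigns span `𝔽₂^m`, then every element `g` of `𝔽₂^m` is the multisign of some
Hamiltonian circle of `Σ_n = (K_n, σ, 𝔽₂^m)`. -/
theorem spanning_disjoint_squares_realize_all_multisigns
    (n m t : ℕ) (ht : 1 ≤ t) (htn : 4 * t ≤ n)
    (σ : Sym2 (Fin n) → (Fin m → ZMod 2))
    (q : Fin t → Fin 4 → Fin n)
    (hq : Function.Injective fun p : Fin t × Fin 4 => q p.1 p.2)
    (hspan : Submodule.span (ZMod 2)
        (Set.range fun i : Fin t =>
          σ s(q i 0, q i 1) + σ s(q i 1, q i 2) + σ s(q i 2, q i 3) + σ s(q i 3, q i 0))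
      = ⊤) :
    ∀ g : Fin m → ZMod 2,
      ∃ (v : Fin n) (H : (⊤ : SimpleGraph (Fin n)).Walk v v),
        H.IsHamiltonianCycle ∧ (H.edges.map σ).sum = g := by
  intro g
  obtain ⟨t, rfl⟩ := Nat.exists_eq_add_of_le' ht
  have hnd : ((List.ofFn q).flatMap List.ofFn).Nodup := by
    rw [List.nodup_flatMap]
    refine ⟨?_, List.pairwise_ofFn.mpr fun i j hij => ?_⟩
    · simp only [List.mem_ofFn, forall_exists_index, forall_apply_eq_imp_iff]
      exact fun i => List.nodup_ofFn.mpr fun a b hab => congrArg Prod.snd (@hq (i, a) (i, b) hab)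
    · intro v hi hj
      obtain ⟨a, rfl⟩ := List.mem_ofFn.mp hi
      obtain ⟨b, hb⟩ := List.mem_ofFn.mp hj
      exact hij.ne' (congrArg Prod.fst (@hq (j, b) (i, a) hb))
  obtain ⟨L, hL, hLu⟩ :=
    hnd.subperm (l₂ := (Finset.univ : Finset (Fin n)).toList) fun v _ => by simp
  obtain ⟨M, hM⟩ := hLu.exists_perm_append
  replace hM := hM.trans (hL.append_right M)
  have hmem : {r | r ∈ List.ofFn q} = Set.range q := Set.ext fun _ => List.mem_ofFn
  have htop : Submodule.span (ZMod 2) (squareSign σ '' {r | r ∈ List.ofFn q}) = ⊤ := by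
    rw [hmem, ← Set.range_comp]
    exact hspan
  have hset (r : Fin 4 → Fin n) (L) : {s | s ∈ r :: L} = insert r {s | s ∈ L} := by ext; simp
  rw [List.ofFn_succ, hset, Set.image_insert_eq] at htop
  rw [List.ofFn_succ] at hM
  obtain ⟨c, hc⟩ := exists_perm_pathSign_eq_add σ M (List.ofFn fun i : Fin t => q i.succ)
  have hg : g - (σ s(q 0 0, q 0 1) + c (q 0 1) (q 0 3) + σ s(q 0 2, q 0 3) + σ s(q 0 2, q 0 0)) ∈
    Submodule.span (ZMod 2) _ := htop ▸ Submodule.mem_top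
  obtain ⟨a, s, hs, hgs⟩ := Submodule.mem_span_insert.mp hg
  obtain ⟨p, hp, hpc⟩ := hc s hs
  obtain ⟨p', hp', hp'c⟩ := exists_pathSign_eq_add_smul_squareSign σ (q 0) p a
  obtain ⟨H, hH, hHs⟩ := exists_isHamiltonianCycle_of_perm_univ σ (x := q 0 0) (l := p')
    (by simp [hp'.length_eq]) (by
      refine List.Perm.trans ?_ hM.symm
      simpa [List.ofFn_succ] using hp'.trans (((hp.cons _).cons _).cons _))
  refine ⟨_, H, hH, ?_⟩
  rw [hHs, hp'c, hpc, sub_eq_iff_eq_add.mp hgs]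
  abel
end

section
/- Let Σ_n = (K_n, σ, F_2^m) be a multisigned complete graph with n ≥ 3, and let x_1, x_2, ..., x_k ∈ F_2^m (k ≥ 1). Suppose every triangle of K_n has multisign belonging to {x_1, x_2, ..., x_k}. Let U := span_{F_2}{ x_1 + x_2, x_1 + x_3, ..., x_1 + x_k }. Then for every Hamiltonian circle H of Σ_n: if n is even, σ(H) ∈ U, and if n is odd, σ(H) ∈ x_1 + U. -/
/-- If every triangle through the base point `r` has label in `c + U`, then adding `c` once per edge
to the label of a closed walk at `r` in a complete graph lands in `U`. -/
theorem sum_edges_add_length_nsmul_mem {V M : Type*} [AddCommGroup M] [Module (ZMod 2) M]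
    (U : Submodule (ZMod 2) M) (σ : Sym2 V → M) (c : M) (r : V)
    (htri : ∀ a b : V, r ≠ a → a ≠ b → r ≠ b →
      σ s(r, a) + σ s(a, b) + σ s(b, r) + c ∈ U)
    (p : (⊤ : SimpleGraph V).Walk r r) :
    (p.edges.map σ).sum + p.length • c ∈ U := by
  classical
  let f : V → M := fun a => if r = a then c else σ s(r, a)
  have self_add (y : M) : y + y = 0 := ZModModule.add_self y
  have edge_mem (a b : V) (hab : a ≠ b) : σ s(a, b) + f a + f b + c ∈ U := by
    by_cases ha : r = a
    · subst ha
      have h : σ s(r, b) + f r + f b + c = (σ s(r, b) + σ s(r, b)) + (c + c) := by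
        simp only [f, if_true, if_neg hab]
        abel
      simp [h, self_add]
    · by_cases hb : r = b
      · subst hb
        have h : σ s(a, r) + f a + f r + c = (σ s(r, a) + σ s(r, a)) + (c + c) := by
          simp only [f, if_true, if_neg ha, Sym2.eq_swap (a := a) (b := r)]
          abel
        simp [h, self_add]
      · convert htri a b ha hab hb using 1
        simp only [f, if_neg ha, if_neg hb, Sym2.eq_swap (a := b) (b := r)]
        abel
  have walk_mem {a b : V} (q : (⊤ : SimpleGraph V).Walk a b) :
      (q.edges.map σ).sum + q.length • c + f a + f b ∈ U := by
    induction q with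
    | nil => simp [self_add]
    | @cons a d b hadj q ih =>
      have h : ((SimpleGraph.Walk.cons hadj q).edges.map σ).sum
          + (SimpleGraph.Walk.cons hadj q).length • c + f a + f b
          = (σ s(a, d) + f a + f d + c) + ((q.edges.map σ).sum + q.length • c + f d + f b)
            - (f d + f d) := by
        simp only [SimpleGraph.Walk.edges_cons, SimpleGraph.Walk.length_cons, List.map_cons,
          List.sum_cons, succ_nsmul]
        abel
      rw [h, self_add, sub_zero]
      exact U.add_mem (edge_mem a d hadj.ne) ih
  simpa [add_assoc, self_add] using walk_mem p

/-- If every triangle of `Σ_n = (K_n, σ, 𝔽₂^m)` (`n ≥ 3`) has multisign among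
`x 0, x 1, …, x (k-1)` (`k ≥ 1`), and `U := span_{𝔽₂}{x ⟨0, hk⟩ + x j : j}`, then the multisign of
every Hamiltonian circle lies in `U` when `n` is even, and in the coset `x 0 + U` when `n`
is odd. -/
theorem hamiltonian_sign_in_coset_of_triangle_signs (n m k : ℕ) (hn : 3 ≤ n) (hk : 1 ≤ k)
    (σ : Sym2 (Fin n) → (Fin m → ZMod 2))
    (x : Fin k → (Fin m → ZMod 2))
    (htri : ∀ a b c : Fin n, a ≠ b → b ≠ c → a ≠ c →
      ∃ j : Fin k, σ s(a, b) + σ s(b, c) + σ s(c, a) = x j)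
    (v : Fin n) (H : (⊤ : SimpleGraph (Fin n)).Walk v v)
    (hH : H.IsHamiltonianCycle) :
    (Even n →
      (H.edges.map σ).sum ∈
        Submodule.span (ZMod 2) (Set.range fun j : Fin k => x ⟨0, hk⟩ + x j)) ∧
    (Odd n →
      ∃ u ∈ Submodule.span (ZMod 2) (Set.range fun j : Fin k => x ⟨0, hk⟩ + x j),
        (H.edges.map σ).sum = x ⟨0, hk⟩ + u) := by
  have self_add (y : Fin m → ZMod 2) : y + y = 0 := ZModModule.add_self y
  have hmem := sum_edges_add_length_nsmul_mem
    (Submodule.span (ZMod 2) (Set.range fun j : Fin k => x ⟨0, hk⟩ + x j)) σ (x ⟨0, hk⟩) v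
    (fun a b ha hab hb => by
      obtain ⟨j, hj⟩ := htri v a b ha hab hb
      rw [hj, add_comm]
      exact Submodule.subset_span ⟨j, rfl⟩) H
  rw [hH.length_eq, Fintype.card_fin] at hmem
  refine ⟨?_, ?_⟩
  · rintro ⟨l, rfl⟩
    simpa [add_nsmul, self_add] using hmem
  · rintro ⟨l, rfl⟩
    refine ⟨_, hmem, ?_⟩
    rw [succ_nsmul, mul_nsmul, two_nsmul, self_add, smul_zero, zero_add, add_left_comm, self_add, add_zero]
end

section
/- Let k ≥ 3 and n ≥ k + 1, and let Σ_n = (K_n, σ, F_2^m) be a multisigned complete graph. Suppose there are a vertex w and k distinct vertices u_1, ..., u_k, all different from w, such that σ(w u_j) = s_j for j = 1, ..., k, where s_1, ..., s_k ∈ F_2^m are linearly independent over F_2, and σ(e) = 0 for every edge e not among {w u_1, ..., w u_k}. Then no Hamiltonian circle H of Σ_n has multisign σ(H) = s_1 + s_2 + ... + s_k. -/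
/-- At most two edges of a cycle are incident to a given vertex. -/
theorem SimpleGraph.Walk.IsCycle.card_le_two_of_forall_mem_edges {V ι : Type*} [Fintype ι]
    {G : SimpleGraph V} {v w : V} {p : G.Walk v v} (hp : p.IsCycle) {u : ι → V}
    (hu : Function.Injective u) (h : ∀ j, s(w, u j) ∈ p.edges) : Fintype.card ι ≤ 2 := by
  rcases isEmpty_or_nonempty ι with _ | ⟨⟨j⟩⟩
  · simp
  have hcard := hp.ncard_neighborSet_toSubgraph_eq_two (p.fst_mem_support_of_mem_edges (h j))
  rw [← hcard, ← Nat.card_eq_fintype_card, ← Set.ncard_range_of_injective hu]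
  refine Set.ncard_le_ncard ?_ (Set.finite_of_ncard_ne_zero (by omega))
  rintro _ ⟨i, rfl⟩
  exact p.adj_toSubgraph_iff_mem_edges.mpr (h i)

/-- In a linearly independent family over a nontrivial semiring, only the full subset sum equals
the sum of the whole family. -/
theorem LinearIndependent.eq_univ_of_sum_eq {R M ι : Type*} [Semiring R] [Nontrivial R]
    [AddCommMonoid M] [Module R M] [Fintype ι] {s : ι → M} (hs : LinearIndependent R s)
    {J : Finset ι} (h : ∑ j ∈ J, s j = ∑ j, s j) : J = Finset.univ := by
  classical
  refine Finset.eq_univ_of_forall fun j => ?_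
  have := Fintype.linearIndependent_iffₛ.mp hs (fun i => if i ∈ J then 1 else 0) 1
    (by simpa [Finset.sum_ite_mem] using h) j
  by_contra hj
  simp [hj] at this

/-- exceptional case: star: in `Σ_n = (K_n, σ, 𝔽₂^m)` with `k ≥ 3` and
`n ≥ k + 1`, if the edges `w u_1, …, w u_k` at a common vertex `w` carry linearly
independent multisigns `s 1, …, s k` and all other edges carry multisign `0`, then no
Hamiltonian circle has multisign `s 1 + ⋯ + s k`. -/
theorem no_hamiltonian_with_full_star_sign (n m k : ℕ) (hk : 3 ≤ k) (hn : k + 1 ≤ n)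
    (σ : Sym2 (Fin n) → (Fin m → ZMod 2))
    (w : Fin n) (u : Fin k → Fin n)
    (hu : Function.Injective u) (huw : ∀ j, u j ≠ w)
    (s : Fin k → (Fin m → ZMod 2))
    (hs : LinearIndependent (ZMod 2) s)
    (hσ : ∀ j, σ s(w, u j) = s j)
    (hzero : ∀ a b : Fin n, a ≠ b → (∀ j, s(a, b) ≠ s(w, u j)) → σ s(a, b) = 0) :
    ∀ (v : Fin n) (H : (⊤ : SimpleGraph (Fin n)).Walk v v),
      H.IsHamiltonianCycle → (H.edges.map σ).sum ≠ ∑ j, s j := by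
  intro v H hH hsum
  classical
  let star : Fin k → Sym2 (Fin n) := fun j => s(w, u j)
  have hstar : Function.Injective star := fun i j hij => hu (Sym2.congr_right.mp hij)
  let J : Finset (Fin k) := {j | star j ∈ H.edges}
  have hJ : (H.edges.map σ).sum = ∑ j ∈ J, s j := by
    rw [← List.sum_toFinset σ hH.isCycle.edges_nodup]
    calc ∑ e ∈ H.edges.toFinset, σ e = ∑ e ∈ J.image star, σ e := by
          refine (Finset.sum_subset (fun e he => ?_) fun e he hne => ?_).symm
          · obtain ⟨j, hj, rfl⟩ := Finset.mem_image.mp he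
            exact List.mem_toFinset.mpr (Finset.mem_filter.mp hj).2
          · induction e with | _ a b
            have hab := List.mem_toFinset.mp he
            refine hzero a b (H.adj_of_mem_edges hab).ne fun j hj => hne ?_
            exact Finset.mem_image.mpr
              ⟨j, by simpa [J, star, ← hj] using hab, hj.symm⟩
      _ = ∑ j ∈ J, s j := by
          rw [Finset.sum_image hstar.injOn]
          exact Finset.sum_congr rfl fun j _ => hσ j
  have hJ_univ : J = Finset.univ := hs.eq_univ_of_sum_eq (hJ.symm.trans hsum)
  have hcard := hH.isCycle.card_le_two_of_forall_mem_edges hu fun j =>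
    (Finset.mem_filter.mp (hJ_univ ▸ Finset.mem_univ j : j ∈ J)).2
  rw [Fintype.card_fin] at hcard
  omega
end

section
/- Let n ≥ 4 and let Σ_n = (K_n, σ, F_2^m) be a multisigned complete graph. Suppose there are three distinct vertices a, b, c such that σ(ab) = s_1, σ(bc) = s_2, σ(ca) = s_3, where s_1, s_2, s_3 ∈ F_2^m are linearly independent over F_2, and σ(e) = 0 for every other edge e of K_n. Then no Hamiltonian circle H of Σ_n has multisign σ(H) = s_1 + s_2 + s_3. -/
/-- A vertex set that no edge of a walk leaves contains either all vertices of the walk or none. -/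
theorem SimpleGraph.Walk.mem_iff_mem_of_edges_closed {V : Type*} {G : SimpleGraph V} {S : Set V}
    {u w : V} (p : G.Walk u w) (hS : ∀ x y, s(x, y) ∈ p.edges → (x ∈ S ↔ y ∈ S)) :
    ∀ x ∈ p.support, (x ∈ S ↔ u ∈ S) := by
  induction p with
  | nil => simp
  | cons h p ih =>
    intro x hx
    rw [Walk.support_cons, List.mem_cons] at hx
    rcases hx with rfl | hx
    · rfl
    · rw [ih (fun y z hyz => hS y z (by simp [hyz])) x hx]
      exact (hS _ _ (by simp)).symm

/-- On a cycle through edges `xy` and `xz` with `y ≠ z`, the only neighbours of `x` are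
`y` and `z`. -/
theorem SimpleGraph.Walk.IsCycle.eq_or_eq_of_mem_edges {V : Type*} {G : SimpleGraph V}
    {u x y z w : V} {p : G.Walk u u} (hp : p.IsCycle) (hyz : y ≠ z)
    (hy : s(x, y) ∈ p.edges) (hz : s(x, z) ∈ p.edges) (hw : s(x, w) ∈ p.edges) :
    w = y ∨ w = z := by
  have h2 := hp.ncard_neighborSet_toSubgraph_eq_two (p.fst_mem_support_of_mem_edges hy)
  have hsub : ({y, z} : Set V) ⊆ p.toSubgraph.neighborSet x := by
    rintro t (rfl | rfl)
    · exact p.adj_toSubgraph_iff_mem_edges.2 hy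
    · exact p.adj_toSubgraph_iff_mem_edges.2 hz
  have heq := Set.eq_of_subset_of_ncard_le hsub (by rw [h2, Set.ncard_pair hyz])
    (Set.finite_of_ncard_ne_zero (by omega))
  have hmem : w ∈ p.toSubgraph.neighborSet x := p.adj_toSubgraph_iff_mem_edges.2 hw
  rw [← heq] at hmem
  simpa using hmem

/-- A cycle containing all three edges of a triangle visits only the vertices of that triangle. -/
theorem SimpleGraph.Walk.IsCycle.mem_triangle_of_mem_support {V : Type*} {G : SimpleGraph V}
    {u a b c : V} {p : G.Walk u u} (hp : p.IsCycle) (hab : a ≠ b) (hbc : b ≠ c) (hac : a ≠ c)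
    (h1 : s(a, b) ∈ p.edges) (h2 : s(b, c) ∈ p.edges) (h3 : s(c, a) ∈ p.edges) :
    ∀ x ∈ p.support, x ∈ ({a, b, c} : Set V) := by
  have closed : ∀ x y, s(x, y) ∈ p.edges → x ∈ ({a, b, c} : Set V) →
      y ∈ ({a, b, c} : Set V) := by
    rintro x y hxy (rfl | rfl | rfl)
    · rcases hp.eq_or_eq_of_mem_edges hbc h1 (Sym2.eq_swap ▸ h3) hxy with rfl | rfl <;> simp
    · rcases hp.eq_or_eq_of_mem_edges hac (Sym2.eq_swap ▸ h1) h2 hxy with rfl | rfl <;> simp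
    · rcases hp.eq_or_eq_of_mem_edges hab h3 (Sym2.eq_swap ▸ h2) hxy with rfl | rfl <;> simp
  have hiff := p.mem_iff_mem_of_edges_closed fun x y hxy =>
    ⟨closed x y hxy, closed y x (Sym2.eq_swap ▸ hxy)⟩
  intro x hx
  exact (hiff x hx).2 ((hiff a (p.fst_mem_support_of_mem_edges h1)).1 (by simp))


/-- exceptional case: triangle: in `Σ_n = (K_n, σ, 𝔽₂^m)` with `n ≥ 4`, if the
three edges of a triangle `a b c` carry linearly independent multisigns `s₁, s₂, s₃` and all
other edges carry multisign `0`, then no Hamiltonian circle has multisign `s₁ + s₂ + s₃`. -/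
theorem no_hamiltonian_with_full_triangle_sign (n m : ℕ) (hn : 4 ≤ n)
    (σ : Sym2 (Fin n) → (Fin m → ZMod 2))
    (a b c : Fin n) (hab : a ≠ b) (hbc : b ≠ c) (hac : a ≠ c)
    (s₁ s₂ s₃ : Fin m → ZMod 2)
    (hs : LinearIndependent (ZMod 2) ![s₁, s₂, s₃])
    (h1 : σ s(a, b) = s₁) (h2 : σ s(b, c) = s₂) (h3 : σ s(c, a) = s₃)
    (hzero : ∀ x y : Fin n, x ≠ y →
      s(x, y) ≠ s(a, b) → s(x, y) ≠ s(b, c) → s(x, y) ≠ s(c, a) → σ s(x, y) = 0) :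
    ∀ (v : Fin n) (H : (⊤ : SimpleGraph (Fin n)).Walk v v),
      H.IsHamiltonianCycle → (H.edges.map σ).sum ≠ s₁ + s₂ + s₃ := by
  intro v H hH hsum
  have hcyc := hH.isCycle
  have hne₁ : s(a, b) ≠ s(b, c) := by simp [hab, hac]
  have hne₂ : s(a, b) ≠ s(c, a) := by simp [hac, hbc]
  have hne₃ : s(b, c) ≠ s(c, a) := by simp [hbc, hab.symm]
  have hσ : ∀ e ∈ H.edges.toFinset, σ e =
      (if e = s(a, b) then s₁ else 0) + (if e = s(b, c) then s₂ else 0) +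
        (if e = s(c, a) then s₃ else 0) := by
    intro e he
    by_cases e1 : e = s(a, b)
    · subst e1; simp only [h1, hne₁, hne₂, if_true, if_false, add_zero]
    by_cases e2 : e = s(b, c)
    · subst e2; simp only [h2, hne₁.symm, hne₃, if_true, if_false, add_zero, zero_add]
    by_cases e3 : e = s(c, a)
    · subst e3; simp only [h3, hne₂.symm, hne₃.symm, if_true, if_false, zero_add]
    induction e with | _ x y =>
    have hxy : x ≠ y := (H.adj_of_mem_edges (List.mem_toFinset.1 he)).ne
    simp only [e1, e2, e3, if_false, add_zero, hzero x y hxy e1 e2 e3]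
  rw [← List.sum_toFinset σ hcyc.edges_nodup, Finset.sum_congr rfl hσ, Finset.sum_add_distrib,
    Finset.sum_add_distrib, Finset.sum_ite_eq', Finset.sum_ite_eq', Finset.sum_ite_eq'] at hsum
  simp only [List.mem_toFinset] at hsum
  have hcoeff := LinearIndependent.eq_coords_of_eq hs
    (f := ![if s(a, b) ∈ H.edges then 1 else 0, if s(b, c) ∈ H.edges then 1 else 0,
      if s(c, a) ∈ H.edges then 1 else 0]) (g := ![1, 1, 1])
    (by simpa [Fin.sum_univ_three, ite_smul] using hsum)
  have m1 : s(a, b) ∈ H.edges := by simpa using hcoeff 0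
  have m2 : s(b, c) ∈ H.edges := by simpa using hcoeff 1
  have m3 : s(c, a) ∈ H.edges := by simpa using hcoeff 2
  have huniv : (Finset.univ : Finset (Fin n)) ⊆ {a, b, c} := fun x _ => by
    simpa using hcyc.mem_triangle_of_mem_support hab hbc hac m1 m2 m3 x (hH.mem_support x)
  have hcard := (Finset.card_le_card huniv).trans Finset.card_le_three
  rw [Finset.card_univ, Fintype.card_fin] at hcard
  omega
end

section
/- Let n ≥ 3. Every path P in the complete graph K_n (a sequence of distinct vertices joined by consecutive edges, possibly covering only part of the vertex set) is contained in some Hamiltonian circle of K_n; that is, there exists a Hamiltonian circle H of K_n such that every edge of P is an edge of H. -/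
namespace SimpleGraph.Walk

/-- In a finite complete graph every path can be prolonged at its start to a Hamiltonian path. -/
theorem IsPath.exists_isHamiltonian_top {V : Type*} [Fintype V] [DecidableEq V] {x y : V}
    {P : (⊤ : SimpleGraph V).Walk x y} (hP : P.IsPath) :
    ∃ (z : V) (Q : (⊤ : SimpleGraph V).Walk z y),
      Q.IsHamiltonian ∧ P.edges ⊆ Q.edges := by
  induction hk : Fintype.card V - P.length generalizing x with
  | zero => have := hP.length_lt; omega
  | succ k ih =>
    by_cases hmem : ∀ w, w ∈ P.support
    · exact ⟨x, P, hP.isHamiltonian_of_mem hmem, fun _ he => he⟩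
    · push Not at hmem
      obtain ⟨w, hw⟩ := hmem
      have hadj : (⊤ : SimpleGraph V).Adj w x := by
        rw [top_adj]
        rintro rfl
        exact hw P.start_mem_support
      obtain ⟨z, Q, hQ, hsub⟩ := ih (hP.cons (h := hadj) hw) (by rw [length_cons]; omega)
      exact ⟨z, Q, hQ, fun e he => hsub (by simp [he])⟩

/-- A Hamiltonian path on at least three vertices whose ends are adjacent closes up to a
Hamiltonian cycle. -/
theorem IsHamiltonian.isHamiltonianCycle_cons {V : Type*} [Fintype V] [DecidableEq V]
    {G : SimpleGraph V} {x y : V} {Q : G.Walk x y} (hQ : Q.IsHamiltonian)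
    (hV : 3 ≤ Fintype.card V) (h : G.Adj y x) : (cons h Q).IsHamiltonianCycle := by
  have hlen := hQ.length_eq
  rw [isHamiltonianCycle_iff_isCycle_and_length_eq, cons_isCycle_iff, length_cons]
  refine ⟨⟨hQ.isPath, fun he => ?_⟩, by omega⟩
  have := hQ.isPath.length_eq_one_of_mem_edges (Sym2.eq_swap ▸ he)
  omega

end SimpleGraph.Walk

/-- For `n ≥ 3`, every path `P` in the complete graph `K_n` is contained in
some Hamiltonian circle `H` of `K_n`, in the sense that every edge of `P` is an edge
of `H`. -/
theorem path_extends_to_hamiltonian (n : ℕ) (hn : 3 ≤ n)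
    (x y : Fin n) (P : (⊤ : SimpleGraph (Fin n)).Walk x y) (hP : P.IsPath) :
    ∃ (v : Fin n) (H : (⊤ : SimpleGraph (Fin n)).Walk v v),
      H.IsHamiltonianCycle ∧ ∀ e ∈ P.edges, e ∈ H.edges := by
  obtain ⟨z, Q, hQ, hsub⟩ := hP.exists_isHamiltonian_top
  have hlen := hQ.length_eq
  rw [Fintype.card_fin] at hlen
  have hadj : (⊤ : SimpleGraph (Fin n)).Adj y z := by
    rw [SimpleGraph.top_adj]
    rintro rfl
    have := SimpleGraph.Walk.isPath_iff_nil.mp hQ.isPath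
    rw [← SimpleGraph.Walk.length_eq_zero_iff] at this
    omega
  exact ⟨y, .cons hadj Q, hQ.isHamiltonianCycle_cons (by simpa using hn) hadj,
    fun e he => by simp [hsub he]⟩
end

section
/- Let m ≥ 1. There exists N such that for every n ≥ N the following holds: let Σ_n = (K_n, σ, F_2^m) be a multisigned complete graph, suppose v_1, v_2, ..., v_{m+1} are distinct vertices of K_n with σ(v_i v_{i+1}) = s_i for i = 1, ..., m, where s_1, ..., s_m are linearly independent over F_2 (hence a basis of F_2^m), and σ(e) = 0 for every edge e not among the path edges v_1v_2, ..., v_m v_{m+1}. Then for every y ∈ F_2^m there exists a Hamiltonian circle H of Σ_n with σ(H) = y. -/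
open SimpleGraph in
/-- In a complete graph, a path that contains every vertex of `S` but misses some vertex extends to
a Hamiltonian path ending outside `S`, without changing the label sum if all edges with an endpoint
outside `S` carry label `0`. -/
lemma exists_isHamiltonian_extension {V M : Type*} [Fintype V] [DecidableEq V] [AddMonoid M]
    (σ : Sym2 V → M) (S : Set V) (hσ : ∀ a b : V, a ≠ b → b ∉ S → σ s(a, b) = 0)
    {u w : V} (p : (⊤ : SimpleGraph V).Walk u w) (hp : p.IsPath) (hS : ∀ a ∈ S, a ∈ p.support)
    (hcard : p.support.length < Fintype.card V) :
    ∃ (x : V) (q : (⊤ : SimpleGraph V).Walk u x),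
      x ∉ S ∧ q.IsHamiltonian ∧ (q.edges.map σ).sum = (p.edges.map σ).sum := by
  induction hd : Fintype.card V - p.support.length generalizing w with
  | zero => omega
  | succ d ih =>
    obtain ⟨x, hx⟩ : ∃ x, x ∉ p.support := by
      by_contra! h
      have h1 := (hp.isHamiltonian_of_mem h).length_support
      omega
    have hwx : w ≠ x := by
      rintro rfl
      exact hx p.end_mem_support
    have hxS : x ∉ S := fun h => hx (hS x h)
    have hadj : (⊤ : SimpleGraph V).Adj w x := hwx
    have hq : (p.concat hadj).IsPath := hp.concat hx hadj
    have hsum : ((p.concat hadj).edges.map σ).sum = (p.edges.map σ).sum := by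
      simp [Walk.edges_concat, hσ w x hwx hxS]
    by_cases h : p.support.length + 1 < Fintype.card V
    · obtain ⟨z, q, hz, hH, hs⟩ := ih (p.concat hadj) hq
        (fun a ha => by simp [Walk.support_concat, hS a ha])
        (by simpa [Walk.support_concat] using h)
        (by simp only [Walk.support_concat, List.length_append,
              List.length_singleton]; omega)
      exact ⟨z, q, hz, hH, hs.trans hsum⟩
    · refine ⟨x, p.concat hadj, hxS, ?_, hsum⟩
      rw [Walk.isHamiltonian_iff_isPath_and_length_eq]
      refine ⟨hq, ?_⟩
      rw [Walk.length_support] at hcard h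
      rw [Walk.length_concat]
      omega

open SimpleGraph in
/-- In a complete graph on at least three vertices, a Hamiltonian path whose closing edge has
label `0` closes up to a Hamiltonian cycle with the same label sum. -/
lemma exists_isHamiltonianCycle_of_isHamiltonian {V M : Type*} [Fintype V] [DecidableEq V]
    [AddMonoid M] (σ : Sym2 V → M) {u x : V} (p : (⊤ : SimpleGraph V).Walk u x)
    (hp : p.IsHamiltonian) (hcard : 3 ≤ Fintype.card V) (hσ : σ s(x, u) = 0) :
    ∃ H : (⊤ : SimpleGraph V).Walk x x,
      H.IsHamiltonianCycle ∧ (H.edges.map σ).sum = (p.edges.map σ).sum := by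
  have hlen := hp.length_eq
  have hxu : x ≠ u := by
    rintro rfl
    have := Walk.isPath_iff_nil.mp hp.isPath |>.eq_nil
    subst this
    simp at hlen
    omega
  have hadj : (⊤ : SimpleGraph V).Adj x u := hxu
  refine ⟨Walk.cons hadj p, ?_, by simp [hσ]⟩
  rw [Walk.isHamiltonianCycle_iff_isCycle_and_length_eq, Walk.cons_isCycle_iff]
  refine ⟨⟨hp.isPath, fun h => ?_⟩, ?_⟩
  · have := hp.isPath.length_eq_one_of_mem_edges (Sym2.eq_swap ▸ h)
    omega
  · rw [Walk.length_cons]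
    omega

open SimpleGraph in
/-- If the edges of the path `v 0 – ⋯ – v m` carry labels `s i` and all other edges carry label
`0`, then any subset sum of the labels is the label sum of a path visiting `v 0, …, v i` in
order: unwanted edges are bypassed through vertices off the path. -/
lemma exists_isPath_sum_eq {V M : Type*} [Fintype V] [DecidableEq V] [AddCommMonoid M] {m : ℕ}
    (hV : 3 * m + 2 ≤ Fintype.card V)
    (σ : Sym2 V → M) (v : Fin (m + 1) → V) (s : Fin m → M) (hv : Function.Injective v)
    (hs : ∀ i : Fin m, σ s(v i.castSucc, v i.succ) = s i)
    (hσ : ∀ a b : V, a ≠ b → b ∉ Set.range v → σ s(a, b) = 0) (T : Finset (Fin m))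
    (i : Fin (m + 1)) :
    ∃ p : (⊤ : SimpleGraph V).Walk (v 0) (v i), p.IsPath ∧ p.length ≤ 2 * i ∧
      (∀ j, v j ∈ p.support ↔ j ≤ i) ∧
      (p.edges.map σ).sum = ∑ j ∈ T with j.castSucc < i, s j := by
  induction i using Fin.induction with
  | zero => exact ⟨Walk.nil, by simp, by simp, fun j => by simp [hv.eq_iff], by simp⟩
  | succ i ih =>
    obtain ⟨p, hp, hlen, hmem, hsum⟩ := ih
    have hlt : i.castSucc < i.succ := Fin.castSucc_lt_succ
    have hnot : v i.succ ∉ p.support := by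
      rw [hmem]
      exact not_le.mpr hlt
    have hne : v i.castSucc ≠ v i.succ := hv.ne hlt.ne
    by_cases hT : i ∈ T
    · have hadj : (⊤ : SimpleGraph V).Adj (v i.castSucc) (v i.succ) := hne
      have hfilter : ({j ∈ T | j.castSucc < i.succ} : Finset (Fin m)) =
          insert i ({j ∈ T | j.castSucc < i.castSucc} : Finset (Fin m)) := by
        ext j
        simp only [Finset.mem_filter, Finset.mem_insert, Fin.lt_def, Fin.ext_iff, Fin.val_castSucc,
          Fin.val_succ]
        constructor
        · rintro ⟨h1, h2⟩
          by_cases h : (j : ℕ) = i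
          · exact Or.inl h
          · exact Or.inr ⟨h1, by omega⟩
        · rintro (h | ⟨h1, h2⟩)
          · obtain rfl := Fin.ext h
            exact ⟨hT, by omega⟩
          · exact ⟨h1, by omega⟩
      refine ⟨p.concat hadj, hp.concat hnot hadj, ?_, fun j => ?_, ?_⟩
      · rw [Walk.length_concat]
        simp only [Fin.val_castSucc, Fin.val_succ] at hlen ⊢
        omega
      · simp only [Walk.support_concat, List.mem_append, List.mem_singleton,
          hmem, hv.eq_iff, Fin.le_def, Fin.ext_iff, Fin.val_castSucc, Fin.val_succ]
        omega
      · rw [hfilter, Finset.sum_insert (by simp), ← hsum, Walk.edges_concat]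
        simp [hs, add_comm]
    · have hfilter : ({j ∈ T | j.castSucc < i.succ} : Finset (Fin m)) =
          ({j ∈ T | j.castSucc < i.castSucc} : Finset (Fin m)) := by
        ext j
        simp only [Finset.mem_filter, Fin.lt_def, Fin.val_castSucc, Fin.val_succ]
        refine and_congr_right fun h1 => ?_
        have : (j : ℕ) ≠ i := fun h => hT (Fin.ext h ▸ h1)
        omega
      obtain ⟨x, hx⟩ : ∃ x, x ∉ p.support.toFinset ∪ Finset.univ.image v := by
        by_contra! h
        have h1 : Fintype.card V ≤ _ := Finset.card_le_card fun x _ => h x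
        have h2 := Finset.card_union_le p.support.toFinset (Finset.univ.image v)
        have h3 := p.support.toFinset_card_le
        have h4 : (Finset.univ.image v).card ≤ m + 1 := by
          simpa using Finset.card_image_le (s := Finset.univ) (f := v)
        have h5 := i.isLt
        rw [Walk.length_support] at h3
        simp only [Fin.val_castSucc] at hlen
        omega
      simp only [Finset.mem_union, List.mem_toFinset, Finset.mem_image, Finset.mem_univ, true_and,
        not_or] at hx
      obtain ⟨hxp, hxv⟩ := hx
      have hxv' : ∀ j, v j ≠ x := fun j h => hxv ⟨j, h⟩
      have hadj₁ : (⊤ : SimpleGraph V).Adj (v i.castSucc) x := hxv' _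
      have hadj₂ : (⊤ : SimpleGraph V).Adj x (v i.succ) := (hxv' _).symm
      refine ⟨(p.concat hadj₁).concat hadj₂, (hp.concat hxp hadj₁).concat ?_ hadj₂, ?_,
        fun j => ?_, ?_⟩
      · simp [Walk.support_concat, hnot, hxv']
      · simp only [Walk.length_concat, Fin.val_castSucc, Fin.val_succ] at hlen ⊢
        omega
      · simp only [Walk.support_concat, List.mem_append, List.mem_singleton,
          hmem, hv.eq_iff, hxv', or_false, Fin.le_def, Fin.ext_iff, Fin.val_castSucc, Fin.val_succ]
        omega
      · have h1 : σ s(v i.castSucc, x) = 0 := hσ _ _ (hxv' _) hxv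
        have h2 : σ s(x, v i.succ) = 0 := by
          rw [Sym2.eq_swap]
          exact hσ _ _ (hxv' _) hxv
        rw [hfilter, ← hsum]
        simp [Walk.edges_concat, h1, h2]

/-- Case 2: labels on a path: for every `m ≥ 1` there is an `N` such that
for all `n ≥ N`, if the edges of a path `v 0 – v 1 – ⋯ – v m` in `K_n` carry linearly
independent multisigns `s 0, …, s (m-1)` (a basis of `𝔽₂^m`) and every other edge carries
multisign `0`, then every `y ∈ 𝔽₂^m` is the multisign of some Hamiltonian circle. -/
theorem path_labels_realize_all_multisigns (m : ℕ) (hm : 1 ≤ m) :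
    ∃ N : ℕ, ∀ n : ℕ, N ≤ n →
      ∀ (σ : Sym2 (Fin n) → (Fin m → ZMod 2)) (v : Fin (m + 1) → Fin n)
        (s : Fin m → (Fin m → ZMod 2)),
        Function.Injective v →
        LinearIndependent (ZMod 2) s →
        (∀ i : Fin m, σ s(v i.castSucc, v i.succ) = s i) →
        (∀ a b : Fin n, a ≠ b →
          (∀ i : Fin m, s(a, b) ≠ s(v i.castSucc, v i.succ)) → σ s(a, b) = 0) →
        ∀ y : Fin m → ZMod 2,
          ∃ (w : Fin n) (H : (⊤ : SimpleGraph (Fin n)).Walk w w),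
            H.IsHamiltonianCycle ∧ (H.edges.map σ).sum = y := by
  refine ⟨3 * m + 2, fun n hn σ v s hv hlin hs hσ y => ?_⟩
  have hσ' : ∀ a b : Fin n, a ≠ b → b ∉ Set.range v → σ s(a, b) = 0 := by
    refine fun a b hab hb => hσ a b hab fun i h => hb ?_
    have : b ∈ s(v i.castSucc, v i.succ) := h ▸ Sym2.mem_mk_right a b
    rcases Sym2.mem_iff.mp this with rfl | rfl <;> exact Set.mem_range_self _
  have hspan := hlin.span_eq_top_of_card_eq_finrank' (by simp)
  obtain ⟨c, hc⟩ := (Submodule.mem_span_range_iff_exists_fun (ZMod 2)).mp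
    (hspan ▸ Submodule.mem_top : y ∈ Submodule.span (ZMod 2) (Set.range s))
  have hcard : 3 * m + 2 ≤ Fintype.card (Fin n) := by simpa using hn
  obtain ⟨p, hp, hlen, hmem, hsum⟩ := exists_isPath_sum_eq hcard σ v s hv hs hσ'
    {i | c i = 1} (Fin.last m)
  have hy : (p.edges.map σ).sum = y := by
    rw [hsum, ← hc, Finset.filter_true_of_mem fun j _ => Fin.castSucc_lt_last j, Finset.sum_filter]
    refine Finset.sum_congr rfl fun i _ => ?_
    rcases (by decide : ∀ z : ZMod 2, z = 0 ∨ z = 1) (c i) with h | h <;> simp [h]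
  obtain ⟨x, q, hx, hq, hqs⟩ := exists_isHamiltonian_extension σ (Set.range v) hσ' p hp
    (by rintro _ ⟨j, rfl⟩; exact (hmem j).mpr (Fin.le_last j))
    (by rw [SimpleGraph.Walk.length_support]; rw [Fin.val_last] at hlen; omega)
  have hclose : σ s(x, v 0) = 0 := by
    rw [Sym2.eq_swap]
    exact hσ' _ _ (fun h => hx ⟨0, h⟩) hx
  obtain ⟨H, hH, hHs⟩ := exists_isHamiltonianCycle_of_isHamiltonian σ q hq (by omega) hclose
  exact ⟨x, H, hH, hHs.trans (hqs.trans hy)⟩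
end
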